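/- For all integers r > 2 and s > 1 and all τ ∈ ℍ, Z^{𝐨𝐞}_{r,s}(τ) = Σ_{m > m′ > 0, m odd, m′ even} φ_r(mτ) φ_s(m′τ) + ζ̃(s) · Σ_{m odd, m > 0} φ_r(mτ). -/

import Mathlib

noncomputable section

open Complex

/-- `φ_k(z) = ((-1)^k/(k-1)!) ∑_{u≥1} u^{k-1} e^{2πiz·u}`. -/
def phi (k : ℕ) (z : ℂ) : ℂ :=
  ((-1 : ℂ) ^ k / (Nat.factorial (k - 1) : ℂ)) *
    ∑' u : ℕ, ((u : ℂ) + 1) ^ (k - 1) * Complex.exp (2 * ↑Real.pi * Complex.I * z) ^ (u + 1)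

/-- `f^𝐨_r(τ) = ∑_{m odd, m>0} φ_r(mτ)`. -/
def fo (r : ℕ) (τ : ℂ) : ℂ := ∑' m : ℕ, phi r ((2 * (m : ℂ) + 1) * τ)

/-- `f^𝐞_r(τ) = ∑_{m even, m>0} φ_r(mτ)`. -/
def fe (r : ℕ) (τ : ℂ) : ℂ := ∑' m : ℕ, phi r ((2 * (m : ℂ) + 2) * τ)

/-- `f̄^𝐨_s(τ) = -∑_{m odd, m>0} m φ_{s+1}(mτ)`. -/
def fbo (s : ℕ) (τ : ℂ) : ℂ :=
  -∑' m : ℕ, (2 * (m : ℂ) + 1) * phi (s + 1) ((2 * (m : ℂ) + 1) * τ)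

/-- `f̄^𝐞_s(τ) = -∑_{m even, m>0} m φ_{s+1}(mτ)`. -/
def fbe (s : ℕ) (τ : ℂ) : ℂ :=
  -∑' m : ℕ, (2 * (m : ℂ) + 2) * phi (s + 1) ((2 * (m : ℂ) + 2) * τ)

/-- `f^{𝐞𝐨}_{r,s}(τ) = ∑_{m>m'>0, m even, m' odd} φ_r(mτ)φ_s(m'τ)`. -/
def feo (r s : ℕ) (τ : ℂ) : ℂ :=
  ∑' x : {p : ℤ × ℤ // 0 < p.2 ∧ p.2 < p.1 ∧ Even p.1 ∧ Odd p.2},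
    phi r ((x.1.1 : ℂ) * τ) * phi s ((x.1.2 : ℂ) * τ)

/-- `f^{𝐨𝐞}_{r,s}(τ) = ∑_{m>m'>0, m odd, m' even} φ_r(mτ)φ_s(m'τ)`. -/
def foe (r s : ℕ) (τ : ℂ) : ℂ :=
  ∑' x : {p : ℤ × ℤ // 0 < p.2 ∧ p.2 < p.1 ∧ Odd p.1 ∧ Even p.2},
    phi r ((x.1.1 : ℂ) * τ) * phi s ((x.1.2 : ℂ) * τ)

/-- `f^{𝐨𝐨}_{r,s}(τ) = ∑_{m>m'>0, m, m' odd} φ_r(mτ)φ_s(m'τ)`. -/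
def foo (r s : ℕ) (τ : ℂ) : ℂ :=
  ∑' x : {p : ℤ × ℤ // 0 < p.2 ∧ p.2 < p.1 ∧ Odd p.1 ∧ Odd p.2},
    phi r ((x.1.1 : ℂ) * τ) * phi s ((x.1.2 : ℂ) * τ)

/-- `ζ̃(k) = (2πi)^{-k} ζ(k)` for `k ≥ 2`, and `ζ̃(1) = 0`. -/
def ztilde (k : ℕ) : ℂ :=
  if k = 1 then 0 else riemannZeta k * ((2 * ↑Real.pi * Complex.I) ^ k)⁻¹

/-- `mτ + n > 0` means `m > 0`, or `m = 0` and `n > 0`. -/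
def posL (m n : ℤ) : Prop := 0 < m ∨ (m = 0 ∧ 0 < n)

/-- The double Eisenstein series `Z^{𝐞𝐨}_{r,s}(τ)`: the sum over
`m ∈ 𝐞, m' ∈ 𝐨, n, n' ∈ ℤ` with `mτ+n > m'τ+n' > 0` of
`(2πi)^{-r-s}/((mτ+n)^r (m'τ+n')^s)`. -/
def ZeoSeries (r s : ℕ) (τ : ℂ) : ℂ :=
  ((2 * ↑Real.pi * Complex.I) ^ (r + s))⁻¹ *
    ∑' x : {x : (ℤ × ℤ) × (ℤ × ℤ) // Even x.1.1 ∧ Odd x.2.1 ∧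
        posL (x.1.1 - x.2.1) (x.1.2 - x.2.2) ∧ posL x.2.1 x.2.2},
      1 / (((x.1.1.1 : ℂ) * τ + (x.1.1.2 : ℂ)) ^ r * ((x.1.2.1 : ℂ) * τ + (x.1.2.2 : ℂ)) ^ s)

/-- The double Eisenstein series `Z^{𝐨𝐞}_{r,s}(τ)` (now `m ∈ 𝐨`, `m' ∈ 𝐞`). -/
def ZoeSeries (r s : ℕ) (τ : ℂ) : ℂ :=
  ((2 * ↑Real.pi * Complex.I) ^ (r + s))⁻¹ *
    ∑' x : {x : (ℤ × ℤ) × (ℤ × ℤ) // Odd x.1.1 ∧ Even x.2.1 ∧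
        posL (x.1.1 - x.2.1) (x.1.2 - x.2.2) ∧ posL x.2.1 x.2.2},
      1 / (((x.1.1.1 : ℂ) * τ + (x.1.1.2 : ℂ)) ^ r * ((x.1.2.1 : ℂ) * τ + (x.1.2.2 : ℂ)) ^ s)

/-- The double Eisenstein series `Z^{𝐨𝐨}_{r,s}(τ)` (now `m, m' ∈ 𝐨`). -/
def ZooSeries (r s : ℕ) (τ : ℂ) : ℂ :=
  ((2 * ↑Real.pi * Complex.I) ^ (r + s))⁻¹ *
    ∑' x : {x : (ℤ × ℤ) × (ℤ × ℤ) // Odd x.1.1 ∧ Odd x.2.1 ∧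
        posL (x.1.1 - x.2.1) (x.1.2 - x.2.2) ∧ posL x.2.1 x.2.2},
      1 / (((x.1.1.1 : ℂ) * τ + (x.1.1.2 : ℂ)) ^ r * ((x.1.2.1 : ℂ) * τ + (x.1.2.2 : ℂ)) ^ s)

/-- Lipschitz's formula, in terms of `phi`. -/
theorem tsum_one_div_add_int_pow_eq_phi {k : ℕ} (hk : 1 < k) {z : ℂ} (hz : 0 < z.im) :
    ∑' n : ℤ, 1 / (z + n) ^ k = (2 * ↑Real.pi * I) ^ k * phi k z := by
  obtain ⟨j, rfl⟩ : ∃ j, k = j + 1 := ⟨k - 1, by omega⟩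
  have hj : 1 ≤ j := by omega
  have h := EisensteinSeries.qExpansion_identity hj ⟨z, hz⟩
  have hsum : Summable fun n : ℕ ↦ (n : ℂ) ^ j * exp (2 * Real.pi * I * z) ^ n := by
    simpa using summable_pow_mul_cexp j 1 ⟨z, hz⟩
  change ∑' n : ℤ, 1 / (z + n) ^ (j + 1) =
    _ * ∑' n : ℕ, (n : ℂ) ^ j * exp (2 * Real.pi * I * z) ^ n at h
  rw [h, hsum.tsum_eq_zero_add, phi, Nat.add_sub_cancel,
    show (-2 * Real.pi * I : ℂ) = -1 * (2 * Real.pi * I) by ring, mul_pow]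
  simp only [Nat.cast_add, Nat.cast_one, Nat.cast_zero, zero_pow (by omega : j ≠ 0), zero_mul,
    zero_add]
  ring

theorem summable_one_div_add_int_pow {k : ℕ} (hk : 1 < k) (z : ℂ) :
    Summable fun n : ℤ ↦ 1 / (z + n) ^ k := by
  simpa using EisensteinSeries.linear_right_summable z 1 (k := k) (by exact_mod_cast hk)

theorem riemannZeta_eq_tsum_one_div_add_one_pow {s : ℕ} (hs : 1 < s) :
    riemannZeta s = ∑' k : ℕ, 1 / ((k : ℂ) + 1) ^ s := by
  simpa using zeta_eq_tsum_one_div_nat_add_one_cpow (s := s) (by simpa using hs)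

theorem summable_one_div_add_one_pow {s : ℕ} (hs : 1 < s) :
    Summable fun k : ℕ ↦ 1 / ((k : ℂ) + 1) ^ s := by
  have h : Summable fun k : ℕ ↦ 1 / (k : ℂ) ^ s := by
    simpa using Complex.summable_one_div_nat_cpow (p := s).2 (by simpa using hs)
  simpa using (summable_nat_add_iff 1).2 h

/-- A summable weight on `ℤ`; products of it dominate the terms of the double series. -/
def latticeWeight (k : ℤ) : ℝ := (max 1 |(k : ℝ)|) ^ (-(5 / 4) : ℝ)

theorem latticeWeight_nonneg (k : ℤ) : 0 ≤ latticeWeight k := by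
  unfold latticeWeight
  positivity

theorem summable_latticeWeight : Summable latticeWeight := by
  have h : Summable fun k : ℤ ↦ |(k : ℝ)| ^ (-(5 / 4) : ℝ) :=
    Real.summable_abs_int_rpow (by norm_num)
  refine (summable_congr_cofinite ?_).1 h
  filter_upwards [(Set.finite_singleton (0 : ℤ)).compl_mem_cofinite] with k hk
  have hk1 : (1 : ℝ) ≤ |(k : ℝ)| := by exact_mod_cast Int.one_le_abs hk
  rw [latticeWeight, max_eq_right hk1]

theorem rpow_five_fourths_mul_le {M N m n m' n' : ℝ} {r s : ℕ} (hr : 2 < r) (hs : 1 < s)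
    (hm' : 1 ≤ m') (hn' : 1 ≤ n') (hm : 1 ≤ m) (hn : 1 ≤ n) (hmM : m ≤ M) (hnM : n ≤ M)
    (hm'M : m' ≤ M) (hm'N : m' ≤ N) (hn'N : n' ≤ N) :
    m ^ (5 / 4 : ℝ) * n ^ (5 / 4 : ℝ) * (m' ^ (5 / 4 : ℝ) * n' ^ (5 / 4 : ℝ)) ≤
      M ^ r * N ^ s := by
  have hM : 1 ≤ M := hm.trans hmM
  have hN : 1 ≤ N := hm'.trans hm'N
  have h1 : m' ^ (5 / 4 : ℝ) = m' ^ (1 / 2 : ℝ) * m' ^ (3 / 4 : ℝ) := by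
    rw [← Real.rpow_add (by linarith)]
    norm_num
  calc _ ≤ M ^ (5 / 4 : ℝ) * M ^ (5 / 4 : ℝ) *
        ((M ^ (1 / 2 : ℝ) * N ^ (3 / 4 : ℝ)) * N ^ (5 / 4 : ℝ)) := by
        rw [h1]
        gcongr
    _ = (M ^ (5 / 4 : ℝ) * M ^ (5 / 4 : ℝ) * M ^ (1 / 2 : ℝ)) *
        (N ^ (3 / 4 : ℝ) * N ^ (5 / 4 : ℝ)) := by ring
    _ = M ^ 3 * N ^ 2 := by
        rw [← Real.rpow_add (by linarith), ← Real.rpow_add (by linarith),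
          ← Real.rpow_add (by linarith)]
        norm_num
    _ ≤ M ^ r * N ^ s := by
        gcongr <;> assumption

theorem one_le_norm_of_ne_zero {x : Fin 2 → ℤ} (hx : x ≠ 0) : 1 ≤ ‖x‖ := by
  rw [EisensteinSeries.norm_eq_max_natAbs]
  have : x 0 ≠ 0 ∨ x 1 ≠ 0 := by
    by_contra! h
    exact hx (by ext i; fin_cases i <;> simp [h])
  norm_cast
  omega

theorem norm_one_div_pow_mul_pow_le {r s : ℕ} (hr : 2 < r) (hs : 1 < s) (τ : UpperHalfPlane)
    {m n m' n' : ℤ} (hm' : 0 ≤ m') (hmm' : m' < m) (h : m' ≠ 0 ∨ n' ≠ 0) :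
    ‖1 / (((m : ℂ) * τ + n) ^ r * ((m' : ℂ) * τ + n') ^ s)‖ ≤
      (EisensteinSeries.r τ ^ (r + s))⁻¹ * ((latticeWeight m * latticeWeight n) *
        (latticeWeight m' * latticeWeight n')) := by
  set c := EisensteinSeries.r τ
  have hc : 0 < c := EisensteinSeries.r_pos τ
  have hx : ![m, n] ≠ 0 := by
    intro h0
    have := congrFun h0 0
    simp at this
    omega
  have hy : ![m', n'] ≠ 0 := by
    intro h0
    have h1 := congrFun h0 0
    have h2 := congrFun h0 1
    simp at h1 h2
    omega
  have hM := one_le_norm_of_ne_zero hx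
  have hN := one_le_norm_of_ne_zero hy
  have hxτ := EisensteinSeries.r_mul_max_le τ hx
  have hyτ := EisensteinSeries.r_mul_max_le τ hy
  simp only [Matrix.cons_val_zero, Matrix.cons_val_one] at hxτ hyτ
  set M := ‖![m, n]‖
  set N := ‖![m', n']‖
  have hmM : |(m : ℝ)| ≤ M := by exact_mod_cast EisensteinSeries.abs_le_left_of_norm n m
  have hnM : |(n : ℝ)| ≤ M := by exact_mod_cast EisensteinSeries.abs_le_right_of_norm n m
  have hm'N : |(m' : ℝ)| ≤ N := by exact_mod_cast EisensteinSeries.abs_le_left_of_norm n' m'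
  have hn'N : |(n' : ℝ)| ≤ N := by exact_mod_cast EisensteinSeries.abs_le_right_of_norm n' m'
  have hm'M : |(m' : ℝ)| ≤ M := by
    refine le_trans ?_ hmM
    norm_cast
    exact abs_le_abs_of_nonneg hm' hmm'.le
  have key := rpow_five_fourths_mul_le hr hs (le_max_left 1 |(m' : ℝ)|) (le_max_left 1 |(n' : ℝ)|)
    (le_max_left 1 |(m : ℝ)|) (le_max_left 1 |(n : ℝ)|) (max_le hM hmM) (max_le hM hnM)
    (max_le hM hm'M) (max_le hN hm'N) (max_le hN hn'N)
  simp only [latticeWeight, Real.rpow_neg (zero_le_one.trans (le_max_left (1 : ℝ) _)),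
    ← mul_inv]
  rw [norm_div, norm_one, norm_mul, norm_pow, norm_pow, one_div]
  apply inv_anti₀ (by positivity)
  calc _ ≤ c ^ (r + s) * (M ^ r * N ^ s) := by gcongr
    _ = (c * M) ^ r * (c * N) ^ s := by ring
    _ ≤ _ := by gcongr

/-- Absolute convergence of the double Eisenstein series over `0 ≤ m' < m`. -/
theorem summable_one_div_pow_mul_pow {ι : Type*} {r s : ℕ} (hr : 2 < r) (hs : 1 < s) {τ : ℂ}
    (hτ : 0 < τ.im) {g : ι → (ℤ × ℤ) × (ℤ × ℤ)} (hg : g.Injective)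
    (h : ∀ i, 0 ≤ (g i).2.1 ∧ (g i).2.1 < (g i).1.1 ∧ ((g i).2.1 ≠ 0 ∨ (g i).2.2 ≠ 0)) :
    Summable fun i ↦ 1 / ((((g i).1.1 : ℂ) * τ + (g i).1.2) ^ r *
      (((g i).2.1 : ℂ) * τ + (g i).2.2) ^ s) := by
  have hw : Summable fun x : ℤ × ℤ ↦ latticeWeight x.1 * latticeWeight x.2 :=
    summable_latticeWeight.mul_of_nonneg summable_latticeWeight latticeWeight_nonneg
      latticeWeight_nonneg
  have hw0 : 0 ≤ fun x : ℤ × ℤ ↦ latticeWeight x.1 * latticeWeight x.2 :=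
    fun x ↦ mul_nonneg (latticeWeight_nonneg _) (latticeWeight_nonneg _)
  exact .of_norm_bounded (((hw.mul_of_nonneg hw hw0 hw0).comp_injective hg).mul_left _)
    fun i ↦ norm_one_div_pow_mul_pow_le hr hs ⟨τ, hτ⟩ (h i).1 (h i).2.1 (h i).2.2

/-- The pairs `m > m' > 0` with `m` odd and `m'` even. -/
abbrev OddEvenPair : Type := {p : ℤ × ℤ // 0 < p.2 ∧ p.2 < p.1 ∧ Odd p.1 ∧ Even p.2}

/-- The index set of `ZoeSeries`. -/
abbrev OddEvenLattice : Type := {x : (ℤ × ℤ) × (ℤ × ℤ) // Odd x.1.1 ∧ Even x.2.1 ∧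
  posL (x.1.1 - x.2.1) (x.1.2 - x.2.2) ∧ posL x.2.1 x.2.2}

/-- Index set of `ZoeSeries`, split according to `m' > 0` or `m' = 0`. -/
def oddEvenLatticeEquiv : OddEvenPair × (ℤ × ℤ) ⊕ (ℕ × ℤ) × ℕ ≃ OddEvenLattice where
  toFun
    | .inl x => ⟨((x.1.1.1, x.2.1), (x.1.1.2, x.2.2)), x.1.2.2.2.1, x.1.2.2.2.2,
        .inl (sub_pos.2 x.1.2.2.1), .inl x.1.2.1⟩
    | .inr x => ⟨((2 * x.1.1 + 1, x.1.2), (0, x.2 + 1)), ⟨x.1.1, rfl⟩, Even.zero,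
        .inl (by dsimp only; omega), .inr ⟨rfl, by dsimp only; omega⟩⟩
  invFun x :=
    if h : 0 < x.1.2.1 then
      .inl (⟨(x.1.1.1, x.1.2.1), h, by
        obtain ⟨x, h1, h2, h3, h4⟩ := x
        unfold posL at h3
        dsimp only at *
        grind, x.2.1, x.2.2.1⟩, (x.1.1.2, x.1.2.2))
    else .inr ((((x.1.1.1 - 1) / 2).toNat, x.1.1.2), (x.1.2.2 - 1).toNat)
  left_inv := by
    rintro (⟨⟨⟨m, m'⟩, h⟩, n, n'⟩ | ⟨⟨a, n⟩, k⟩)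
    · simp [h.1]
    · simp
  right_inv := by
    rintro ⟨⟨⟨m, n⟩, m', n'⟩, h1, h2, h3, h4⟩
    unfold posL at h3 h4
    dsimp only at h1 h2 h3 h4
    by_cases h : 0 < m'
    · simp [h]
    · obtain ⟨a, rfl⟩ := h1
      have hm' : m' = 0 := by omega
      subst hm'
      simp
      omega

theorem oddEvenLatticeEquiv_inl (x : OddEvenPair × (ℤ × ℤ)) :
    (oddEvenLatticeEquiv (.inl x)).1 = ((x.1.1.1, x.2.1), (x.1.1.2, x.2.2)) := rfl

theorem oddEvenLatticeEquiv_inr (x : (ℕ × ℤ) × ℕ) :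
    (oddEvenLatticeEquiv (.inr x)).1 = ((2 * (x.1.1 : ℤ) + 1, x.1.2), (0, (x.2 : ℤ) + 1)) := rfl

theorem tsum_oddEvenLattice_eq_add {F : OddEvenLattice → ℂ} (hF : Summable F) :
    ∑' x, F x = ∑' x, F (oddEvenLatticeEquiv (.inl x)) +
      ∑' x, F (oddEvenLatticeEquiv (.inr x)) := by
  have h := oddEvenLatticeEquiv.summable_iff.2 hF
  rw [← oddEvenLatticeEquiv.tsum_eq F]
  exact ((h.comp_injective Sum.inl_injective).hasSum.sum
    (h.comp_injective Sum.inr_injective).hasSum).tsum_eq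

theorem tsum_oddEvenPair_prod_eq {r s : ℕ} (hr : 2 < r) (hs : 1 < s) {τ : ℂ} (hτ : 0 < τ.im) :
    ∑' x : OddEvenPair × (ℤ × ℤ), 1 / (((x.1.1.1 : ℂ) * τ + x.2.1) ^ r *
      ((x.1.1.2 : ℂ) * τ + x.2.2) ^ s) = (2 * ↑Real.pi * I) ^ (r + s) * foe r s τ := by
  have hsum : Summable fun x : OddEvenPair × (ℤ × ℤ) ↦ 1 / (((x.1.1.1 : ℂ) * τ + x.2.1) ^ r *
      ((x.1.1.2 : ℂ) * τ + x.2.2) ^ s) :=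
    summable_one_div_pow_mul_pow hr hs hτ
      (g := fun x : OddEvenPair × (ℤ × ℤ) ↦ ((x.1.1.1, x.2.1), (x.1.1.2, x.2.2)))
      (by rintro ⟨⟨⟨m, m'⟩, h⟩, n, n'⟩ ⟨⟨⟨l, l'⟩, h'⟩, k, k'⟩ hx; simp at hx ⊢; tauto)
      fun x ↦ ⟨x.1.2.1.le, x.1.2.2.1, .inl x.1.2.1.ne'⟩
  rw [hsum.tsum_prod, foe, ← tsum_mul_left]
  refine tsum_congr fun p ↦ ?_
  have him {m : ℤ} (hm : 0 < m) : 0 < ((m : ℂ) * τ).im := by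
    have : (0 : ℝ) < m := by exact_mod_cast hm
    simpa using mul_pos this hτ
  calc _ = (∑' n : ℤ, 1 / ((p.1.1 : ℂ) * τ + n) ^ r) *
        ∑' n : ℤ, 1 / ((p.1.2 : ℂ) * τ + n) ^ s := by
        have hp := hsum.prod_factor p
        simp only [← one_div_mul_one_div] at hp ⊢
        exact ((summable_one_div_add_int_pow (by omega) _).tsum_mul_tsum
          (summable_one_div_add_int_pow hs _) hp).symm
    _ = _ := by
        rw [tsum_one_div_add_int_pow_eq_phi (by omega) (him (p.2.1.trans p.2.2.1)),
          tsum_one_div_add_int_pow_eq_phi hs (him p.2.1)]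
        ring

theorem tsum_odd_mul_zeta_eq {r s : ℕ} (hr : 2 < r) (hs : 1 < s) {τ : ℂ} (hτ : 0 < τ.im)
    (hsum : Summable fun x : (ℕ × ℤ) × ℕ ↦
      1 / (((2 * (x.1.1 : ℂ) + 1) * τ + x.1.2) ^ r * ((x.2 : ℂ) + 1) ^ s)) :
    ∑' x : (ℕ × ℤ) × ℕ, 1 / (((2 * (x.1.1 : ℂ) + 1) * τ + x.1.2) ^ r * ((x.2 : ℂ) + 1) ^ s) =
      (2 * ↑Real.pi * I) ^ r * fo r τ * riemannZeta s := by
  have hleft : Summable fun x : ℕ × ℤ ↦ 1 / ((2 * (x.1 : ℂ) + 1) * τ + x.2) ^ r := by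
    simpa using hsum.prod_symm.prod_factor 0
  have him (m : ℕ) : 0 < ((2 * (m : ℂ) + 1) * τ).im := by
    have : (0 : ℝ) < 2 * m + 1 := by positivity
    simpa using mul_pos this hτ
  calc _ = (∑' x : ℕ × ℤ, 1 / ((2 * (x.1 : ℂ) + 1) * τ + x.2) ^ r) *
        ∑' k : ℕ, 1 / ((k : ℂ) + 1) ^ s := by
        simp only [← one_div_mul_one_div] at hsum ⊢
        exact (hleft.tsum_mul_tsum (summable_one_div_add_one_pow hs) hsum).symm
    _ = _ := by
        rw [hleft.tsum_prod, ← riemannZeta_eq_tsum_one_div_add_one_pow hs, fo, ← tsum_mul_left]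
        simp only [tsum_one_div_add_int_pow_eq_phi (by omega : 1 < r) (him _)]

/-- Fourier expansion of `Z^{𝐨𝐞}_{r,s}`. -/
theorem ZoeSeries_eq (r s : ℕ) (hr : 2 < r) (hs : 1 < s) (τ : ℂ) (hτ : 0 < τ.im) :
    ZoeSeries r s τ = foe r s τ + ztilde s * fo r τ := by
  have hsum : Summable fun x : OddEvenLattice ↦ 1 / (((x.1.1.1 : ℂ) * τ + (x.1.1.2 : ℂ)) ^ r *
      ((x.1.2.1 : ℂ) * τ + (x.1.2.2 : ℂ)) ^ s) := by
    refine summable_one_div_pow_mul_pow hr hs hτ Subtype.val_injective ?_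
    rintro ⟨⟨⟨m, n⟩, m', n'⟩, h1, h2, h3, h4⟩
    unfold posL at h3 h4
    dsimp only at *
    grind
  have hsplit := tsum_oddEvenLattice_eq_add hsum
  have hinr_summable := (oddEvenLatticeEquiv.summable_iff.2 hsum).comp_injective Sum.inr_injective
  simp only [Function.comp_def, oddEvenLatticeEquiv_inr, oddEvenLatticeEquiv_inl, Int.cast_add,
    Int.cast_mul, Int.cast_natCast, Int.cast_ofNat, Int.cast_one, Int.cast_zero, zero_mul,
    zero_add] at hsplit hinr_summable
  have hpi : (2 * Real.pi * I : ℂ) ≠ 0 := Complex.two_pi_I_ne_zero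
  rw [ZoeSeries, hsplit, tsum_oddEvenPair_prod_eq hr hs hτ,
    tsum_odd_mul_zeta_eq hr hs hτ hinr_summable, ztilde, if_neg (by omega), pow_add]
  field_simp
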